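/- arXiv:2007.11036 — 5 statements merged into one kernel-verified Lean document; each statement's English description precedes it below -/
import Mathlib

section
/- Fix h, λ ∈ ℂ, and consider the following ℂ-linear endomorphisms of the polynomial ring ℂ[z]: B = d/dz (formal derivative), Φ = h·(multiplication by z), Ψ = λ·id − (multiplication by z)∘(d/dz), and A = (1+h)·id. Then: (i) Φ∘Ψ − Ψ∘Φ = Φ; (ii) Ψ∘B − B∘Ψ = B; (iii) Φ∘B − B∘Φ = id − A; and (iv) Φ∘B + (A − id)∘Ψ = h·λ·id. -/
open Polynomial

/-- The defining relations of the quantum double `D(B_1)` hold for the operators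
`B = d/dz`, `Φ = h·z`, `Ψ = λ - z·d/dz`, `A = (1+h)·id` on `ℂ[z]`:
`[Φ,Ψ] = Φ`, `[Ψ,B] = B`, `[Φ,B] = 1 - A`, and `ΦB + (A-1)Ψ = hλ·id`. -/
theorem quantum_double_relations_on_polynomials (h lam : ℂ) :
    let B : Module.End ℂ (Polynomial ℂ) := Polynomial.derivative
    let Z : Module.End ℂ (Polynomial ℂ) := LinearMap.mulLeft ℂ (Polynomial.X : Polynomial ℂ)
    let Φ : Module.End ℂ (Polynomial ℂ) := h • Z
    let Ψ : Module.End ℂ (Polynomial ℂ) := lam • (1 : Module.End ℂ (Polynomial ℂ)) - Z * B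
    let A : Module.End ℂ (Polynomial ℂ) := (1 + h) • (1 : Module.End ℂ (Polynomial ℂ))
    Φ * Ψ - Ψ * Φ = Φ ∧
    Ψ * B - B * Ψ = B ∧
    Φ * B - B * Φ = 1 - A ∧
    Φ * B + (A - 1) * Ψ = (h * lam) • (1 : Module.End ℂ (Polynomial ℂ)) := by
  intro B Z Φ Ψ A
  refine ⟨?_, ?_, ?_, ?_⟩ <;>
  · refine LinearMap.ext fun p => ?_
    simp only [B, Z, Φ, Ψ, A, LinearMap.sub_apply, LinearMap.add_apply, Module.End.mul_apply,
      LinearMap.smul_apply, Module.End.one_apply, LinearMap.mulLeft_apply,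
      Polynomial.smul_eq_C_mul, Polynomial.derivative_mul, Polynomial.derivative_X,
      Polynomial.derivative_C, Polynomial.derivative_sub, map_add, map_mul, map_one]
    ring
end

section
/- Let R be a commutative ring, n ≥ 2, A an n×n matrix over R, B an (n−1)×(n−1) matrix over R, and r a row vector of length n−1 over R. Suppose C_n⁻¹ · A · C_n equals the block matrix with blocks [[B, 0_{n−1}], [r, 1]], where 0_{n−1} is the zero column of length n−1. Let Â be the top-left (n−1)×(n−1) block of A. Then C_{n−1}⁻¹ · Â · C_{n−1} = B + e·r, where e ∈ R^{n−1} is the last standard basis column vector (0, …, 0, 1)ᵀ and e·r denotes the outer product (the (n−1)×(n−1) matrix whose last row is r and whose other rows are zero). -/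
/-- The upper-triangular matrix `C_k` with `(i,j)` entry `1` if `i ≤ j` and `0` otherwise. -/
def Cmat (k : ℕ) (R : Type*) [CommRing R] : Matrix (Fin k) (Fin k) R :=
  Matrix.of fun i j => if i ≤ j then 1 else 0

/-- The `(m+1)×(m+1)` block matrix `[[B, 0], [r, 1]]` built from an `m×m` matrix `B` and a
row vector `r` of length `m`. -/
def blockMat {R : Type*} [CommRing R] {m : ℕ} (B : Matrix (Fin m) (Fin m) R) (r : Fin m → R) :
    Matrix (Fin (m + 1)) (Fin (m + 1)) R :=
  Matrix.of fun i j =>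
    if hi : (i : ℕ) < m then
      if hj : (j : ℕ) < m then B ⟨i, hi⟩ ⟨j, hj⟩ else 0
    else
      if hj : (j : ℕ) < m then r ⟨j, hj⟩ else 1

theorem Cmat_isUnit_det (k : ℕ) (R : Type*) [CommRing R] : IsUnit (Cmat k R).det := by
  have h : (Cmat k R).BlockTriangular id := by
    intro i j hij
    have : ¬ i ≤ j := not_le.mpr hij
    simp [Cmat, this]
  rw [Matrix.det_of_upperTriangular h]
  simp [Cmat]

/-- If `C_n⁻¹ A C_n = [[B, 0], [r, 1]]` (with `n = m+1 ≥ 2`), then conjugating the top-left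
`m×m` block `Â` of `A` by `C_m` gives `B + e·r`, where `e = (0,…,0,1)ᵀ` and `e·r` is the
outer product. -/
theorem conj_topLeft_block (R : Type*) [CommRing R] (m : ℕ) (hm : 1 ≤ m)
    (A : Matrix (Fin (m + 1)) (Fin (m + 1)) R) (B : Matrix (Fin m) (Fin m) R) (r : Fin m → R)
    (hA : (Cmat (m + 1) R)⁻¹ * A * Cmat (m + 1) R = blockMat B r) :
    (Cmat m R)⁻¹ * A.submatrix Fin.castSucc Fin.castSucc * Cmat m R
      = B + Matrix.vecMulVec (fun i : Fin m => if (i : ℕ) = m - 1 then (1 : R) else 0) r := by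
  have h1 := Cmat_isUnit_det (m + 1) R
  have h2 := Cmat_isUnit_det m R
  have hA' : A * Cmat (m + 1) R = Cmat (m + 1) R * blockMat B r := by
    rw [← hA, Matrix.mul_assoc (Cmat (m + 1) R)⁻¹, Matrix.mul_nonsing_inv_cancel_left _ _ h1]
  have key : A.submatrix Fin.castSucc Fin.castSucc * Cmat m R = Cmat m R *
      (B + Matrix.vecMulVec (fun i : Fin m => if (i : ℕ) = m - 1 then (1 : R) else 0) r) := by
    ext i j
    have h := congrFun (congrFun hA' i.castSucc) j.castSucc
    rw [Matrix.mul_apply, Matrix.mul_apply, Fin.sum_univ_castSucc, Fin.sum_univ_castSucc] at h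
    have hl : ¬ (Fin.last m ≤ j.castSucc) := not_le.mpr (Fin.castSucc_lt_last j)
    have hl' : i.castSucc ≤ Fin.last m := Fin.le_last _
    simp only [Cmat, blockMat, Matrix.of_apply, Fin.castSucc_le_castSucc_iff, hl, hl', if_true,
      if_false, mul_zero, add_zero, Fin.val_castSucc, Fin.is_lt, dif_pos, Fin.val_last,
      lt_irrefl, dif_neg, not_false_eq_true, one_mul, Fin.eta] at h
    rw [Matrix.mul_add, Matrix.add_apply, Matrix.mul_apply, Matrix.mul_apply, Matrix.mul_apply]
    simp only [Cmat, Matrix.of_apply, Matrix.submatrix_apply, Matrix.vecMulVec_apply]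
    rw [h]
    congr 1
    rw [Finset.sum_eq_single (⟨m - 1, by omega⟩ : Fin m)]
    · have : i ≤ (⟨m - 1, by omega⟩ : Fin m) := by
        rw [Fin.le_def]
        have := i.isLt
        simp only
        omega
      simp [this]
    · intro b _ hb
      have : (b : ℕ) ≠ m - 1 := fun h => hb (Fin.ext h)
      simp [this]
    · simp
  rw [Matrix.mul_assoc, key, Matrix.nonsing_inv_mul_cancel_left _ _ h2]
end

section
/- Let R be a commutative ring, n ≥ 2, A an n×n matrix over R, B an (n−1)×(n−1) matrix over R, and r a row vector of length n−1 over R. Suppose C_n⁻¹ · A · C_n equals the block matrix with blocks [[B, 0_{n−1}], [r, 1]]. Let Â be the top-left (n−1)×(n−1) block of A. Then det(Â − I_{n−1}) = det(B − I_{n−1} + e·r), where e ∈ R^{n−1} is the last standard basis column vector and e·r the outer product (the matrix whose last row is r and whose other rows are zero). -/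
theorem Cmat_det (k : ℕ) (R : Type*) [CommRing R] : (Cmat k R).det = 1 := by
  rw [Matrix.det_of_upperTriangular]
  · simp [Cmat]
  · intro i j hij
    have h : j < i := hij
    simp [Cmat, not_le.mpr h]

/-- If `C_n⁻¹ A C_n = [[B, 0], [r, 1]]` (with `n = m+1 ≥ 2`), then
`det(Â - I) = det(B - I + e·r)`, where `Â` is the top-left `m×m` block of `A`,
`e = (0,…,0,1)ᵀ` and `e·r` is the outer product. -/
theorem det_topLeft_block_sub_one (R : Type*) [CommRing R] (m : ℕ) (hm : 1 ≤ m)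
    (A : Matrix (Fin (m + 1)) (Fin (m + 1)) R) (B : Matrix (Fin m) (Fin m) R) (r : Fin m → R)
    (hA : (Cmat (m + 1) R)⁻¹ * A * Cmat (m + 1) R = blockMat B r) :
    (A.submatrix Fin.castSucc Fin.castSucc - 1).det
      = (B - 1 + Matrix.vecMulVec (fun i : Fin m => if (i : ℕ) = m - 1 then (1 : R) else 0) r).det := by
  have hu : IsUnit (Cmat (m + 1) R).det := by rw [Cmat_det]; exact isUnit_one
  have h1 : A * Cmat (m + 1) R = Cmat (m + 1) R * blockMat B r := by
    rw [← hA, Matrix.mul_assoc, Matrix.mul_nonsing_inv_cancel_left _ _ hu]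
  set e : Fin m → R := fun i : Fin m => if (i : ℕ) = m - 1 then (1 : R) else 0 with he
  have hCe : ∀ i, ∑ k, Cmat m R i k * e k = 1 := by
    intro i
    have hi := i.isLt
    rw [Finset.sum_eq_single (⟨m - 1, by omega⟩ : Fin m)]
    · have : i ≤ (⟨m - 1, by omega⟩ : Fin m) := by
        rw [Fin.le_def]; simp only; omega
      simp [Cmat, he, this]
    · intro b _ hb
      have : (b : ℕ) ≠ m - 1 := fun h => hb (Fin.ext h)
      simp [he, this]
    · simp
  have h2 : A.submatrix Fin.castSucc Fin.castSucc * Cmat m R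
      = Cmat m R * (B + Matrix.vecMulVec e r) := by
    ext i j
    have h := congrFun (congrFun h1 i.castSucc) j.castSucc
    rw [Matrix.mul_apply, Matrix.mul_apply, Fin.sum_univ_castSucc, Fin.sum_univ_castSucc] at h
    have hl : ¬ Fin.last m ≤ j.castSucc := not_le.mpr (Fin.castSucc_lt_last j)
    simp [Cmat, blockMat, hl, Fin.le_last] at h
    have h3 : ∑ k, Cmat m R i k * (e k * r j) = r j := by
      simp_rw [← mul_assoc]
      rw [← Finset.sum_mul, hCe, one_mul]
    rw [Matrix.mul_add, Matrix.add_apply, Matrix.mul_apply, Matrix.mul_apply, Matrix.mul_apply]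
    simp only [Matrix.vecMulVec_apply]
    rw [h3]
    simpa [Cmat] using h
  have h4 : (A.submatrix Fin.castSucc Fin.castSucc - 1) * Cmat m R
      = Cmat m R * (B - 1 + Matrix.vecMulVec e r) := by
    rw [sub_mul, h2]
    noncomm_ring
  have h5 := congrArg Matrix.det h4
  simpa [Matrix.det_mul, Cmat_det] using h5
end

section
/- Let F be a field, t ∈ F with t ≠ 0 and t^n ≠ 1, and n ≥ 2. Let A be an n×n matrix over F, B an (n−1)×(n−1) matrix over F, and r a row vector of length n−1 over F such that C_n⁻¹ · A · C_n equals the block matrix [[B, 0_{n−1}], [r, 1]], and such that (1 − t^n)·r = Σ_{i=1}^{n−1} (t^i − 1)·a_i, where a_i denotes the i-th row of B − I_{n−1}. Let Â be the top-left (n−1)×(n−1) block of A. Then det(I_{n−1} − Â) = (−1)^{n−1} · t^{n−1} · ((1 − t)/(1 − t^n)) · det(B − I_{n−1}). -/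
/-- If `C_n⁻¹ A C_n = [[B, 0], [r, 1]]` (with `n = m+1 ≥ 2`) and
`(1 - tⁿ) r = Σ_{i=1}^{n-1} (tⁱ - 1) a_i` where `a_i` is the `i`-th row of `B - I`, then
`det(I - Â) = (-1)^{n-1} t^{n-1} ((1-t)/(1-tⁿ)) det(B - I)`, where `Â` is the top-left
block of `A`. -/
theorem det_one_sub_topLeft_block (F : Type*) [Field F] (t : F) (m : ℕ) (hm : 1 ≤ m)
    (ht : t ≠ 0) (htn : t ^ (m + 1) ≠ 1)
    (A : Matrix (Fin (m + 1)) (Fin (m + 1)) F) (B : Matrix (Fin m) (Fin m) F) (r : Fin m → F)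
    (hA : (Cmat (m + 1) F)⁻¹ * A * Cmat (m + 1) F = blockMat B r)
    (hr : ∀ j, (1 - t ^ (m + 1)) * r j = ∑ i : Fin m, (t ^ ((i : ℕ) + 1) - 1) * (B - 1) i j) :
    ((1 : Matrix (Fin m) (Fin m) F) - A.submatrix Fin.castSucc Fin.castSucc).det
      = (-1) ^ m * t ^ m * ((1 - t) / (1 - t ^ (m + 1))) * (B - 1).det := by
  have hC : A * Cmat (m + 1) F = Cmat (m + 1) F * blockMat B r := by
    rw [← hA, Matrix.mul_assoc, Matrix.mul_nonsing_inv_cancel_left]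
    rw [Cmat_det]; exact isUnit_one
  have hne : (1 - t ^ (m + 1)) ≠ 0 := sub_ne_zero.mpr (Ne.symm htn)
  obtain ⟨k, rfl⟩ : ∃ k, m = k + 1 := ⟨m - 1, by omega⟩
  let v : Fin (k + 1) → F := fun i => (t ^ ((i : ℕ) + 1) - 1) / (1 - t ^ (k + 1 + 1))
  let e : Fin (k + 1) → F := Pi.single (Fin.last k) 1
  have hrv : r = Matrix.vecMul v (B - 1) := by
    funext j
    apply mul_left_cancel₀ hne
    rw [hr j, Matrix.vecMul, dotProduct, Finset.mul_sum]
    refine Finset.sum_congr rfl fun i _ => ?_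
    simp only [v]
    field_simp
  have h1 : (1 - A.submatrix Fin.castSucc Fin.castSucc) * Cmat (k + 1) F
      = -(Cmat (k + 1) F * (B - 1) + Matrix.vecMulVec (fun _ => 1) r) := by
    ext i j
    have h := congrFun (congrFun hC i.castSucc) j.castSucc
    rw [Matrix.mul_apply, Matrix.mul_apply, Fin.sum_univ_castSucc,
      Fin.sum_univ_castSucc (n := k + 1)] at h
    have hl : ¬ Fin.last (k + 1) ≤ j.castSucc := not_le.mpr (Fin.castSucc_lt_last j)
    have hl' : i.castSucc ≤ Fin.last (k + 1) := Fin.le_last _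
    simp only [Cmat, blockMat, Matrix.of_apply, hl, hl', if_true, if_false, Fin.val_castSucc,
      Fin.val_last, Fin.is_lt, dif_pos, lt_irrefl, dif_neg, not_false_eq_true, Fin.eta,
      Fin.castSucc_le_castSucc_iff, mul_zero, add_zero, one_mul] at h
    rw [Matrix.sub_mul, Matrix.mul_sub, Matrix.one_mul, Matrix.mul_one]
    simp only [Matrix.sub_apply, Matrix.neg_apply, Matrix.add_apply, Matrix.mul_apply,
      Matrix.vecMulVec_apply, Matrix.submatrix_apply, Cmat, Matrix.of_apply, one_mul]
    rw [h]
    ring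
  have hCe : Matrix.mulVec (Cmat (k + 1) F) e = fun _ => 1 := by
    funext i
    simp [e, Cmat, Fin.le_last]
  have h2 : Cmat (k + 1) F * (B - 1) + Matrix.vecMulVec (fun _ => 1) r
      = Cmat (k + 1) F * ((1 + Matrix.vecMulVec e v) * (B - 1)) := by
    rw [Matrix.add_mul, Matrix.mul_add, Matrix.one_mul, Matrix.vecMulVec_mul, ← hrv,
      Matrix.mul_vecMulVec, hCe]
  have h3 : (1 + Matrix.vecMulVec e v).det = t ^ (k + 1) * ((1 - t) / (1 - t ^ (k + 1 + 1))) := by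
    rw [Matrix.vecMulVec_eq Unit, Matrix.det_one_add_replicateCol_mul_replicateRow]
    simp only [e, v, dotProduct_single, Fin.val_last]
    field_simp
    ring
  have h4 := congrArg Matrix.det h1
  rw [Matrix.det_mul, Cmat_det, mul_one, h2, Matrix.det_neg, Matrix.det_mul, Cmat_det,
    Matrix.det_mul, h3, Fintype.card_fin] at h4
  rw [h4]
  ring
end

section
/- Let F be a field, t ∈ F with t ≠ 0, and n ≥ 2. Let A be any finite product of the matrices U_i and their inverses U_i⁻¹ (each U_i is invertible since det U_i = −t ≠ 0), for indices 1 ≤ i ≤ n−1. Write A in block form with Â the top-left (n−1)×(n−1) block, b the last column of A without its last entry (a column vector of length n−1), c the last row of A without its last entry (a row vector of length n−1), and d = A_{n,n}. If I_{n−1} − Â is invertible, then d + c · (I_{n−1} − Â)⁻¹ · b = 1. -/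
open scoped Matrix

/-- The `(m+1)×(m+1)` Burau matrix `U_i` (for `i : Fin m`): the identity matrix except that
its `2×2` submatrix in rows and columns `i, i+1` equals `[[1-t, t], [1, 0]]`. -/
def Umat {R : Type*} [CommRing R] {m : ℕ} (t : R) (i : Fin m) :
    Matrix (Fin (m + 1)) (Fin (m + 1)) R :=
  Matrix.of fun j k =>
    if j = i.castSucc then (if k = i.castSucc then 1 - t else if k = i.succ then t else 0)
    else if j = i.succ then (if k = i.castSucc then 1 else 0)
    else if j = k then 1 else 0

theorem Umat_mulVec_aux {F : Type*} [Field F] {m : ℕ} (t : F) (i : Fin m)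
    (x : Fin (m + 1) → F) (j : Fin (m + 1)) :
    (Umat t i *ᵥ x) j = if j = i.castSucc then (1 - t) * x i.castSucc + t * x i.succ
      else if j = i.succ then x i.castSucc else x j := by
  have hne : i.succ ≠ i.castSucc := (Fin.castSucc_lt_succ).ne'
  simp only [Matrix.mulVec, dotProduct, Umat, Matrix.of_apply]
  split_ifs with h1 h2
  · have : ∀ k, (if k = i.castSucc then 1 - t else if k = i.succ then t else 0) * x k =
        (if k = i.castSucc then (1 - t) * x k else 0) + (if k = i.succ then t * x k else 0) := by
      intro k
      by_cases hk : k = i.castSucc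
      · subst hk
        simp [hne.symm]
      · by_cases hk2 : k = i.succ <;> simp [hk, hk2, hne]
    simp [this, Finset.sum_add_distrib]
  · simp
  · simp

theorem Umat_isUnit_aux {F : Type*} [Field F] {m : ℕ} (t : F) (ht : t ≠ 0) (i : Fin m) :
    IsUnit (Umat t i) := by
  have hne : i.succ ≠ i.castSucc := (Fin.castSucc_lt_succ).ne'
  rw [← Matrix.mulVec_injective_iff_isUnit]
  intro x y hxy
  have h : ∀ j, (Umat t i *ᵥ x) j = (Umat t i *ᵥ y) j := fun j => congrFun hxy j
  simp only [Umat_mulVec_aux] at h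
  have h1 := h i.succ
  simp only [hne, if_false, if_true] at h1
  have h2 := h i.castSucc
  simp only [if_true, h1, add_right_inj] at h2
  have h3 := mul_left_cancel₀ ht h2
  funext j
  have h4 := h j
  by_cases hj : j = i.castSucc
  · rw [hj, h1]
  · by_cases hj2 : j = i.succ
    · rw [hj2, h3]
    · simpa [hj, hj2] using h4

theorem Umat_one_aux {F : Type*} [Field F] {m : ℕ} (t : F) (i : Fin m) :
    Umat t i *ᵥ (1 : Fin (m + 1) → F) = 1 := by
  funext j
  rw [Umat_mulVec_aux]
  simp

/-- For any finite product `A` of the Burau matrices `U_i` and their inverses (`n = m+1 ≥ 2`),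
writing `A = [[Â, b], [c, d]]` in block form, if `I - Â` is invertible then
`d + c (I - Â)⁻¹ b = 1`. -/
theorem burau_block_identity (F : Type*) [Field F] (t : F) (ht : t ≠ 0) (m : ℕ) (hm : 1 ≤ m)
    (A : Matrix (Fin (m + 1)) (Fin (m + 1)) F)
    (hA : A ∈ Submonoid.closure
      (Set.range (fun i : Fin m => Umat t i) ∪ Set.range (fun i : Fin m => (Umat t i)⁻¹)))
    (hinv : IsUnit ((1 : Matrix (Fin m) (Fin m) F) - A.submatrix Fin.castSucc Fin.castSucc)) :
    A (Fin.last m) (Fin.last m) +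
      (fun j : Fin m => A (Fin.last m) j.castSucc) ⬝ᵥ
        (((1 : Matrix (Fin m) (Fin m) F) - A.submatrix Fin.castSucc Fin.castSucc)⁻¹ *ᵥ
          fun i : Fin m => A i.castSucc (Fin.last m)) = 1 := by
  have hone : A *ᵥ (1 : Fin (m + 1) → F) = 1 := by
    clear hinv
    induction hA using Submonoid.closure_induction with
    | mem B hB =>
      rcases hB with ⟨i, rfl⟩ | ⟨i, rfl⟩
      · exact Umat_one_aux t i
      · have hu := (Matrix.isUnit_iff_isUnit_det _).1 (Umat_isUnit_aux t ht i)
        change (Umat t i)⁻¹ *ᵥ (1 : Fin (m + 1) → F) = 1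
        conv_lhs => rw [← Umat_one_aux t i]
        rw [Matrix.mulVec_mulVec, Matrix.nonsing_inv_mul _ hu, Matrix.one_mulVec]
    | one => simp
    | mul B C _ _ hB hC => rw [← Matrix.mulVec_mulVec, hC, hB]
  have hrow : ∀ j, (∑ k : Fin m, A j k.castSucc) + A j (Fin.last m) = 1 := by
    intro j
    have := congrFun hone j
    simpa [Matrix.mulVec, dotProduct, Fin.sum_univ_castSucc] using this
  have hb : (fun i : Fin m => A i.castSucc (Fin.last m)) =
      ((1 : Matrix (Fin m) (Fin m) F) - A.submatrix Fin.castSucc Fin.castSucc) *ᵥ 1 := by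
    funext i
    rw [Matrix.sub_mulVec, Matrix.one_mulVec]
    simp only [Pi.sub_apply, Matrix.mulVec, dotProduct, Matrix.submatrix_apply, Pi.one_apply,
      mul_one]
    rw [← hrow i.castSucc]
    ring
  rw [hb, Matrix.mulVec_mulVec,
    Matrix.nonsing_inv_mul _ ((Matrix.isUnit_iff_isUnit_det _).1 hinv), Matrix.one_mulVec,
    add_comm]
  simpa [dotProduct] using hrow (Fin.last m)
end
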